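/- For every odd integer k ≥ 3, there exists an index i ≥ 0 divisible by k such that v_i = v_{i+k} and v_i ∈ {0,2}; that is, vtm contains an occurrence of a length-(k+1) factor of the form 0u0 or 2u2 at a position congruent to 0 modulo k. -/

import Mathlib

/-- The morphism μ : 0 ↦ 012, 1 ↦ 02, 2 ↦ 1. -/
def mu : Fin 3 → List (Fin 3)
  | 0 => [0, 1, 2]
  | 1 => [0, 2]
  | 2 => [1]

/-- Apply μ to a finite word. -/
def muWord (l : List (Fin 3)) : List (Fin 3) := l.flatMap mu

/-- The word vtm = 012021012102012⋯, the fixed point of μ starting with 0,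
obtained as the limit of μ^n(0): since μ^m(0) is a prefix of μ^(m+1)(0) and
its length exceeds n for m = n+1, the n-th letter is read off from μ^(n+1)(0). -/
def vtm (n : ℕ) : Fin 3 := ((muWord^[n + 1]) [0]).getD n 0

/-- Thue–Morse sequence. -/
def tm (n : ℕ) : ℕ := (Nat.digits 2 n).sum % 2

lemma tm_lt (n : ℕ) : tm n < 2 := Nat.mod_lt _ (by norm_num)

lemma tm_zero : tm 0 = 0 := by simp [tm]

lemma tm_even (n : ℕ) : tm (2 * n) = tm n := by
  rcases Nat.eq_zero_or_pos n with h | h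
  · subst h; rfl
  · have := Nat.digits_add_two_add_one 0 (2 * n - 1)
    have e : 2 * n - 1 + 1 = 2 * n := by omega
    rw [e] at this
    simp [tm, this]

lemma tm_odd (n : ℕ) : tm (2 * n + 1) = 1 - tm n := by
  have := Nat.digits_add_two_add_one 0 (2 * n)
  have e : (2 * n + 1) / 2 = n := by omega
  simp only [zero_add] at this
  rw [e] at this
  simp only [tm, this, List.sum_cons]
  omega

lemma tm_one : tm 1 = 1 := by simpa [tm_zero] using tm_odd 0

lemma tm_block (a : ℕ) : ∀ q r : ℕ, r < 2 ^ a → tm (2 ^ a * q + r) = (tm q + tm r) % 2 := by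
  induction a with
  | zero =>
    intro q r hr
    have : r = 0 := by simpa using hr
    subst this
    have := tm_lt q
    simp [tm_zero]; omega
  | succ a ih =>
    intro q r hr
    have hr' : r / 2 < 2 ^ a := by rw [pow_succ] at hr; omega
    have h := ih q (r / 2) hr'
    have h1 := tm_lt q
    have h2 := tm_lt (r / 2)
    rcases Nat.mod_two_eq_zero_or_one r with hm | hm
    · have e1 : r = 2 * (r / 2) := by omega
      have e2 : 2 ^ (a + 1) * q + r = 2 * (2 ^ a * q + r / 2) := by
        rw [pow_succ]; linarith
      rw [e2, tm_even, h]
      conv_rhs => rw [e1, tm_even]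
    · have e1 : r = 2 * (r / 2) + 1 := by omega
      have e2 : 2 ^ (a + 1) * q + r = 2 * (2 ^ a * q + r / 2) + 1 := by
        rw [pow_succ]; linarith
      rw [e2, tm_odd, h]
      conv_rhs => rw [e1, tm_odd]
      omega

/-- The letter obtained from consecutive Thue–Morse values. -/
def ww (n : ℕ) : Fin 3 := if tm (n + 1) = tm n then 1 else if tm n = 0 then 0 else 2

lemma muWord_ww (n : ℕ) :
    muWord ((List.range n).map ww) = (List.range (2 * n + tm n)).map ww := by
  induction n with
  | zero => simp [muWord, tm_zero]
  | succ n ih =>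
    have e : muWord ((List.range (n + 1)).map ww)
        = muWord ((List.range n).map ww) ++ mu (ww n) := by
      simp [muWord, List.range_succ]
    rw [e, ih]
    have a0 := tm_even n
    have a1 := tm_odd n
    have a2 : tm (2 * n + 2) = tm (n + 1) := tm_even (n + 1)
    have a3 : tm (2 * n + 3) = 1 - tm (n + 1) := tm_odd (n + 1)
    have h1 : tm n = 0 ∨ tm n = 1 := by have := tm_lt n; omega
    have h2 : tm (n + 1) = 0 ∨ tm (n + 1) = 1 := by have := tm_lt (n + 1); omega
    have e2 : 2 * (n + 1) = 2 * n + 2 := by ring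
    rcases h1 with h1 | h1 <;> rcases h2 with h2 | h2 <;>
      simp [e2, h1, h2, List.range_succ, ww, mu, a0, a1, a2, a3]

lemma iter_ww (m : ℕ) : ∃ L, m < L ∧ (muWord^[m]) [0] = (List.range L).map ww := by
  induction m with
  | zero => exact ⟨1, by norm_num, by simp [ww, tm_zero, tm_one]⟩
  | succ m ih =>
    obtain ⟨L, hL, h⟩ := ih
    refine ⟨2 * L + tm L, by omega, ?_⟩
    rw [Function.iterate_succ_apply', h, muWord_ww]

lemma vtm_eq (n : ℕ) : vtm n = ww n := by
  obtain ⟨L, hL, h⟩ := iter_ww (n + 1)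
  have hn : n < L := by omega
  simp [vtm, h, List.getD, hn]

/-- Some occurrence at a half-position. -/
lemma exists_half (l : ℕ) (hl : 1 ≤ l) :
    ∃ j, tm (j + l) = tm (j + l + 1) ∧ tm j ≠ tm (j + l) := by
  have hp : l < 2 ^ l := Nat.lt_two_pow_self
  have hq : 2 ^ (l + 2) = 4 * 2 ^ l := by ring
  have t2 : tm 2 = 1 := by simpa [tm_one] using tm_even 1
  have hA : ∀ q, tm (2 ^ (l + 2) * q + 1) = (tm q + 1) % 2 := fun q => by
    rw [tm_block _ q 1 (by omega), tm_one]
  have hB : ∀ q, tm (2 ^ (l + 2) * q + 2) = (tm q + 1) % 2 := fun q => by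
    rw [tm_block _ q 2 (by omega), t2]
  rcases Nat.eq_or_lt_of_le hl with h | h
  · subst h
    exact ⟨0, by simp [tm_one, t2], by simp [tm_one, tm_zero]⟩
  · set C := 2 ^ (l + 2) + 1 - l with hC
    have hCl : C + l = 2 ^ (l + 2) + 1 := by omega
    have h0 := tm_block (l + 2) 0 C (by omega)
    have h1 := tm_block (l + 2) 1 C (by omega)
    have hc := tm_lt C
    have a1 := hA 1
    have b1 := hB 1
    have a2 := hA 2
    have b2 := hB 2
    rw [tm_one] at a1 b1 h1
    rw [t2] at a2 b2
    by_cases hz : tm C = 0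
    · refine ⟨2 ^ (l + 2) * 1 + C, ?_, ?_⟩
      · rw [show 2 ^ (l + 2) * 1 + C + l = 2 ^ (l + 2) * 2 + 1 by omega, a2, b2]
      · rw [show 2 ^ (l + 2) * 1 + C + l = 2 ^ (l + 2) * 2 + 1 by omega, a2, h1, hz]
        norm_num
    · refine ⟨C, ?_, ?_⟩
      · rw [show C + l = 2 ^ (l + 2) * 1 + 1 by omega, a1, b1]
      · rw [show C + l = 2 ^ (l + 2) * 1 + 1 by omega, a1]
        omega

/-- For every odd k ≥ 3, vtm has an occurrence of a length-(k+1) factor of the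
form 0u0 or 2u2 at a position divisible by k. -/
theorem vtm_odd_occurrence (k : ℕ) (hk : 3 ≤ k) (hodd : Odd k) :
    ∃ i : ℕ, k ∣ i ∧ vtm i = vtm (i + k) ∧ (vtm i = 0 ∨ vtm i = 2) := by
  obtain ⟨l, rfl⟩ := hodd
  obtain ⟨j, hj1, hj2⟩ := exists_half l (by omega)
  set N := 2 * j + (2 * l + 1) + 1 with hN
  have hNp : N < 2 ^ N := Nat.lt_two_pow_self
  have hco : Nat.Coprime (2 * l + 1) (2 ^ N) := by
    apply Nat.Coprime.pow_right
    rw [Nat.coprime_two_right]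
    exact ⟨l, rfl⟩
  obtain ⟨i, hi1, hi2⟩ := Nat.chineseRemainder hco 0 (2 * j)
  have hmod : i % 2 ^ N = 2 * j := by
    rw [hi2, Nat.mod_eq_of_lt (by omega)]
  have hi : i = 2 ^ N * (i / 2 ^ N) + 2 * j := by
    have := Nat.div_add_mod i (2 ^ N)
    omega
  refine ⟨i, (Nat.modEq_zero_iff_dvd).1 hi1, ?_⟩
  generalize i / 2 ^ N = Q at hi
  have c0 := tm_block N Q (2 * j) (by omega)
  have c1 := tm_block N Q (2 * j + 1) (by omega)
  have c2 := tm_block N Q (2 * (j + l) + 1) (by omega)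
  have c3 := tm_block N Q (2 * (j + l + 1)) (by omega)
  rw [show 2 ^ N * Q + 2 * j = i by omega, tm_even] at c0
  rw [show 2 ^ N * Q + (2 * j + 1) = i + 1 by omega, tm_odd] at c1
  rw [show 2 ^ N * Q + (2 * (j + l) + 1) = i + (2 * l + 1) by omega, tm_odd] at c2
  rw [show 2 ^ N * Q + 2 * (j + l + 1) = i + (2 * l + 1) + 1 by omega, tm_even] at c3
  have b0 := tm_lt j
  have b1 := tm_lt (j + l)
  have b2 := tm_lt Q
  have d0 : tm (i + (2 * l + 1)) = tm i := by omega
  have d1 : tm (i + (2 * l + 1) + 1) = tm (i + 1) := by omega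
  have d2 : tm (i + 1) ≠ tm i := by omega
  rw [vtm_eq, vtm_eq]
  unfold ww
  rw [d0, d1, if_neg d2]
  refine ⟨rfl, ?_⟩
  split_ifs <;> simp
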